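/- Let ν ∈ ℂ with Re(ν) > −1 and let f ∈ S_ν([0,∞)). Then for every z ≠ 0, T_ν(H_ν(f))(z) = W_ν(T_ν(f))(z); that is, T_ν(H_ν(f))(z) = |z|^{−ν−1} e^{sgn(z)πi(ν+1)/2} T_ν(f)(−1/z). -/

import Mathlib

open MeasureTheory Set

/-- The classical J-Bessel function of complex index `ν`, via its power series
(principal branch of powers). -/
noncomputable def besselJ (ν : ℂ) (x : ℝ) : ℂ :=
  ∑' k : ℕ, ((-1 : ℂ) ^ k * ((x / 2 : ℝ) : ℂ) ^ (ν + 2 * (k : ℂ))) /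
    (Complex.Gamma ((k : ℂ) + 1) * Complex.Gamma ((k : ℂ) + ν + 1))

/-- `g` and all of its derivatives are rapidly decreasing at `+∞`. -/
def RapidlyDecreasing (g : ℝ → ℂ) : Prop :=
  ∀ m n : ℕ, ∃ C : ℝ, ∀ x : ℝ, 1 ≤ x → x ^ m * ‖iteratedDeriv n g x‖ ≤ C

/-- Membership in the Schwartz space `S([0,∞))`: `f` agrees on `[0,∞)` with a smooth
function on `ℝ` all of whose derivatives are rapidly decreasing at `+∞`. -/
def MemSHalf (f : ℝ → ℂ) : Prop :=
  ∃ g : ℝ → ℂ, ContDiff ℝ (⊤ : ℕ∞) g ∧ (∀ x : ℝ, 0 ≤ x → f x = g x) ∧ RapidlyDecreasing g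

/-- Membership in `S_ν([0,∞))`: `f(x) = x^{(ν+1)/2} f₁(x)` on `[0,∞)` for some
`f₁ ∈ S([0,∞))` (principal branch of the complex power). -/
def MemSnu (ν : ℂ) (f : ℝ → ℂ) : Prop :=
  ∃ f₁ : ℝ → ℂ, MemSHalf f₁ ∧ ∀ x : ℝ, 0 ≤ x → f x = (x : ℂ) ^ ((ν + 1) / 2) * f₁ x

/-- The Hankel transform of order `ν`: `H_ν(f)(y) = ∫₀^∞ f(x) √(xy) J_ν(2√(xy)) dx/x`. -/
noncomputable def hankel (ν : ℂ) (f : ℝ → ℂ) (y : ℝ) : ℂ :=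
  ∫ x in Ioi (0 : ℝ), f x * (Real.sqrt (x * y) : ℂ) * besselJ ν (2 * Real.sqrt (x * y)) / (x : ℂ)

/-- The operator `T_ν(f)(z) = (2π)^{-1/2} ∫₀^∞ x^{(ν-1)/2} f(x) e^{ixz} dx`. -/
noncomputable def Tnu (ν : ℂ) (f : ℝ → ℂ) (z : ℝ) : ℂ :=
  (((2 * Real.pi) ^ (-(1 : ℝ) / 2) : ℝ) : ℂ) *
    ∫ x in Ioi (0 : ℝ), (x : ℂ) ^ ((ν - 1) / 2) * f x * Complex.exp (Complex.I * x * z)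

/-- The operator `W_ν(φ)(x) = |x|^{-ν-1} e^{sgn(x)·πi(ν+1)/2} φ(-1/x)`. -/
noncomputable def Wnu (ν : ℂ) (φ : ℝ → ℂ) (x : ℝ) : ℂ :=
  ((|x| : ℝ) : ℂ) ^ (-ν - 1) *
    Complex.exp (((Real.sign x * Real.pi : ℝ) : ℂ) * Complex.I * (ν + 1) / 2) * φ (-1 / x)

open Filter Topology

/-- The entire function `∑ (-t)^k / (k! Γ(k+ν+1))`, so that
`J_ν(2√t) = t^{ν/2} besselEntire ν t`. -/
noncomputable def besselEntire (ν : ℂ) (t : ℝ) : ℂ :=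
  ∑' k : ℕ, (-1 : ℂ) ^ k * (t : ℂ) ^ k / (k.factorial * Complex.Gamma (k + ν + 1))

lemma natCast_add_ne_zero {ν : ℂ} (hν : -1 < ν.re) (k : ℕ) : (k : ℂ) + ν + 1 ≠ 0 := by
  intro h
  have h' := congrArg Complex.re h
  simp at h'
  have : (0 : ℝ) ≤ k := k.cast_nonneg
  linarith

lemma Gamma_natCast_add_ne_zero {ν : ℂ} (hν : -1 < ν.re) (k : ℕ) :
    Complex.Gamma (k + ν + 1) ≠ 0 := by
  apply Complex.Gamma_ne_zero_of_re_pos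
  have : (0 : ℝ) ≤ k := k.cast_nonneg
  simp
  linarith

lemma Gamma_natCast_add_succ {ν : ℂ} (hν : -1 < ν.re) (k : ℕ) :
    Complex.Gamma ((k : ℂ) + ν + 2) = (k + ν + 1) * Complex.Gamma (k + ν + 1) := by
  rw [← Complex.Gamma_add_one _ (natCast_add_ne_zero hν k)]
  ring_nf

lemma Gamma_re_div_norm_Gamma_le {ν : ℂ} (hν : -1 < ν.re) (k : ℕ) :
    Real.Gamma (k + ν.re + 1) / ‖Complex.Gamma (k + ν + 1)‖ ≤
      Real.Gamma (ν.re + 1) / ‖Complex.Gamma (ν + 1)‖ := by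
  induction k with
  | zero => simp
  | succ k ih =>
    refine le_trans ?_ ih
    have hk : (0 : ℝ) ≤ k := k.cast_nonneg
    have hpos : 0 < k + ν.re + 1 := by linarith
    have e1 : ((k + 1 : ℕ) : ℂ) + ν + 1 = k + ν + 2 := by push_cast; ring
    have e2 : ((k + 1 : ℕ) : ℝ) + ν.re + 1 = (k + ν.re + 1) + 1 := by push_cast; ring
    rw [e1, e2, Gamma_natCast_add_succ hν, Real.Gamma_add_one hpos.ne', norm_mul]
    have hre : k + ν.re + 1 ≤ ‖(k : ℂ) + ν + 1‖ := by
      simpa using Complex.re_le_norm ((k : ℂ) + ν + 1)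
    have hG := norm_pos_iff.2 (Gamma_natCast_add_ne_zero hν k)
    have hG' := Real.Gamma_pos_of_pos hpos
    have hn := hpos.trans_le hre
    rw [div_le_div_iff₀ (by positivity) hG]
    have := mul_le_mul_of_nonneg_right hre (mul_pos hG' hG).le
    nlinarith

lemma exists_inv_norm_Gamma_le {ν : ℂ} (hν : -1 < ν.re) :
    ∃ C A : ℝ, 0 ≤ C ∧ 0 ≤ A ∧ ∀ k : ℕ, ‖Complex.Gamma (k + ν + 1)‖⁻¹ ≤ C * A ^ k := by
  have ha : 0 < ν.re + 1 := by linarith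
  refine ⟨‖Complex.Gamma (ν + 1)‖⁻¹, (ν.re + 1)⁻¹, by positivity, by positivity, fun k ↦ ?_⟩
  induction k with
  | zero => simp
  | succ k ih =>
    have hk : (0 : ℝ) ≤ k := k.cast_nonneg
    have e1 : ((k + 1 : ℕ) : ℂ) + ν + 1 = k + ν + 2 := by push_cast; ring
    have hre : ν.re + 1 ≤ ‖(k : ℂ) + ν + 1‖ := by
      have := Complex.re_le_norm ((k : ℂ) + ν + 1)
      simp at this
      linarith
    rw [e1, Gamma_natCast_add_succ hν, norm_mul, mul_inv, pow_succ, ← mul_assoc, mul_comm]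
    gcongr

lemma norm_besselEntire_term (ν : ℂ) (t : ℝ) (k : ℕ) :
    ‖(-1 : ℂ) ^ k * (t : ℂ) ^ k / (k.factorial * Complex.Gamma (k + ν + 1))‖ =
      |t| ^ k / k.factorial * ‖Complex.Gamma (k + ν + 1)‖⁻¹ := by
  simp [div_eq_mul_inv]
  ring

lemma summable_besselEntire {ν : ℂ} (hν : -1 < ν.re) (t : ℝ) :
    Summable fun k : ℕ ↦
      (-1 : ℂ) ^ k * (t : ℂ) ^ k / (k.factorial * Complex.Gamma (k + ν + 1)) := by
  obtain ⟨C, A, hC, hA, h⟩ := exists_inv_norm_Gamma_le hν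
  refine Summable.of_norm_bounded ((Real.summable_pow_div_factorial (|t| * A)).mul_left C) ?_
  intro k
  rw [norm_besselEntire_term]
  calc _ ≤ |t| ^ k / k.factorial * (C * A ^ k) := by gcongr; exact h k
    _ = _ := by rw [mul_pow]; ring

lemma hasDerivAt_besselEntire {ν : ℂ} (hν : -1 < ν.re) (t : ℝ) :
    HasDerivAt (besselEntire ν) (-besselEntire (ν + 1) t) t := by
  obtain ⟨C, A, hC, hA, h⟩ := exists_inv_norm_Gamma_le hν
  set R : ℝ := |t| + 1 with hR
  have hR1 : 1 ≤ R := by rw [hR]; linarith [abs_nonneg t]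
  set g' : ℕ → ℝ → ℂ := fun k y ↦
    (-1 : ℂ) ^ k * (k * (y : ℂ) ^ (k - 1)) / (k.factorial * Complex.Gamma (k + ν + 1)) with hg'
  have hbound : ∀ (k : ℕ), ∀ y ∈ Metric.ball (0 : ℝ) R,
      ‖g' k y‖ ≤ C * ((2 * R * A) ^ k / k.factorial) := by
    intro k y hy
    have hy' : |y| ≤ R := by simpa using (mem_ball_zero_iff.1 hy).le
    have h1 : ‖g' k y‖ = (k * |y| ^ (k - 1)) / k.factorial * ‖Complex.Gamma (k + ν + 1)‖⁻¹ := by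
      simp only [hg', norm_div, norm_mul, norm_pow, norm_neg, norm_one, one_pow, one_mul,
        Complex.norm_natCast, Complex.norm_real, Real.norm_eq_abs]
      rw [div_mul_eq_div_div, ← div_eq_mul_inv]
    have h2 : (k : ℝ) * |y| ^ (k - 1) ≤ 2 ^ k * R ^ k := by
      have : (k : ℝ) ≤ 2 ^ k := by exact_mod_cast Nat.lt_two_pow_self.le
      have h3 : |y| ^ (k - 1) ≤ R ^ k :=
        (pow_le_pow_left₀ (abs_nonneg y) hy' _).trans (pow_le_pow_right₀ hR1 (Nat.sub_le k 1))
      gcongr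
    rw [h1]
    calc _ ≤ (2 ^ k * R ^ k) / k.factorial * (C * A ^ k) := by gcongr; exact h k
      _ = _ := by rw [mul_pow, mul_pow]; ring
  have hder := hasDerivAt_tsum_of_isPreconnected (𝕜 := ℝ) (y₀ := 0) (y := t)
    (g := fun (k : ℕ) (y : ℝ) ↦
      (-1 : ℂ) ^ k * (y : ℂ) ^ k / (k.factorial * Complex.Gamma (k + ν + 1)))
    ((Real.summable_pow_div_factorial (2 * R * A)).mul_left C) Metric.isOpen_ball
    (convex_ball (0 : ℝ) R).isPreconnected (g' := g') (fun k y _ ↦ ?_) hbound ?_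
    (summable_besselEntire hν 0) ?_
  · refine hder.congr_deriv ?_
    have hs : Summable fun k ↦ g' k t := by
      refine Summable.of_norm_bounded
        ((Real.summable_pow_div_factorial (2 * R * A)).mul_left C) fun k ↦ hbound k t ?_
      simp [hR]
    rw [hs.tsum_eq_zero_add, besselEntire, ← tsum_neg]
    simp only [hg', Nat.cast_zero, zero_mul, mul_zero, zero_div, zero_add]
    refine tsum_congr fun k ↦ ?_
    have hk : ((k : ℂ) + 1) ≠ 0 := by exact_mod_cast k.succ_ne_zero
    have e1 : (k : ℂ) + (ν + 1) + 1 = ((k + 1 : ℕ) : ℂ) + ν + 1 := by push_cast; ring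
    have hG := Gamma_natCast_add_ne_zero hν (k + 1)
    have hf : (k.factorial : ℂ) ≠ 0 := by exact_mod_cast k.factorial_ne_zero
    rw [e1, Nat.factorial_succ, Nat.add_sub_cancel]
    push_cast at hG ⊢
    field_simp
    ring
  · have := (((hasDerivAt_pow k (y : ℂ)).comp_ofReal).const_mul ((-1 : ℂ) ^ k)).div_const
      ((k.factorial : ℂ) * Complex.Gamma (k + ν + 1))
    simpa [hg'] using this
  · simp; positivity
  · simp [hR]

lemma continuous_besselEntire {ν : ℂ} (hν : -1 < ν.re) : Continuous (besselEntire ν) :=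
  continuous_iff_continuousAt.2 fun t ↦ (hasDerivAt_besselEntire hν t).continuousAt

lemma besselEntire_recurrence {ν : ℂ} (hν : -1 < ν.re) (t : ℝ) :
    besselEntire ν t =
      (ν + 1) * besselEntire (ν + 1) t - t * besselEntire (ν + 2) t := by
  have h1 : -1 < (ν + 1).re := by simp; linarith
  have h2 : -1 < (ν + 2).re := by simp; linarith
  have key : besselEntire ν t - (ν + 1) * besselEntire (ν + 1) t =
      -(t * besselEntire (ν + 2) t) := by
    have hs := summable_besselEntire hν t
    have hs1 := (summable_besselEntire h1 t).mul_left (ν + 1)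
    rw [besselEntire, besselEntire, besselEntire, ← tsum_mul_left, ← tsum_mul_left, ← tsum_neg,
      ← hs.tsum_sub hs1, (hs.sub hs1).tsum_eq_zero_add]
    have e0 := Gamma_natCast_add_succ hν 0
    have g0 := natCast_add_ne_zero hν 0
    have g0' := Gamma_natCast_add_ne_zero hν 0
    simp only [Nat.cast_zero, zero_add] at e0 g0 g0'
    have z : (-1 : ℂ) ^ 0 * (t : ℂ) ^ 0 /
        ((Nat.factorial 0 : ℂ) * Complex.Gamma (((0 : ℕ) : ℂ) + ν + 1)) -
      (ν + 1) * ((-1 : ℂ) ^ 0 * (t : ℂ) ^ 0 /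
        ((Nat.factorial 0 : ℂ) * Complex.Gamma (((0 : ℕ) : ℂ) + (ν + 1) + 1))) = 0 := by
      have : ν + 1 + 1 = ν + 2 := by ring
      simp only [Nat.cast_zero, zero_add, this, e0]
      simp
      field_simp
      simp
    rw [z, zero_add]
    refine tsum_congr fun k ↦ ?_
    have hk : ((k : ℂ) + 1) ≠ 0 := by exact_mod_cast k.succ_ne_zero
    have hf : (k.factorial : ℂ) ≠ 0 := by exact_mod_cast k.factorial_ne_zero
    have e := Gamma_natCast_add_succ hν (k + 1)
    have n1 := natCast_add_ne_zero hν (k + 1)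
    have n2 := Gamma_natCast_add_ne_zero hν (k + 1)
    have e3 : (k : ℂ) + (ν + 2) + 1 = ((k + 1 : ℕ) : ℂ) + ν + 2 := by push_cast; ring
    have e4 : ((k + 1 : ℕ) : ℂ) + (ν + 1) + 1 = ((k + 1 : ℕ) : ℂ) + ν + 2 := by push_cast; ring
    rw [e3, e4, e, Nat.factorial_succ]
    push_cast at n1 n2 ⊢
    field_simp
    ring
  rw [sub_eq_iff_eq_add] at key
  rw [key]
  ring

lemma besselEntire_energy_le {μ : ℂ} (hμ : 0 ≤ μ.re) {t : ℝ} (ht : 0 ≤ t) :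
    t * ‖besselEntire (μ + 1) t‖ ^ 2 + ‖besselEntire μ t‖ ^ 2 ≤ ‖besselEntire μ 0‖ ^ 2 := by
  have h0 : -1 < μ.re := by linarith
  have h1 : -1 < (μ + 1).re := by simp; linarith
  have hder : ∀ s : ℝ, HasDerivAt
      (fun t : ℝ ↦ t * ‖besselEntire (μ + 1) t‖ ^ 2 + ‖besselEntire μ t‖ ^ 2)
      (-(2 * μ.re + 1) * ‖besselEntire (μ + 1) s‖ ^ 2) s := by
    intro s
    have d1 := hasDerivAt_besselEntire h1 s
    have d0 := hasDerivAt_besselEntire h0 s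
    have := ((hasDerivAt_id s).mul d1.norm_sq).add d0.norm_sq
    refine this.congr_deriv ?_
    have hrec := besselEntire_recurrence h0 s
    have e : μ + 1 + 1 = μ + 2 := by ring
    rw [e, hrec]
    simp only [Complex.inner, id, ← Complex.normSq_eq_norm_sq, Complex.normSq_apply]
    simp
    ring
  have hanti : AntitoneOn
      (fun t : ℝ ↦ t * ‖besselEntire (μ + 1) t‖ ^ 2 + ‖besselEntire μ t‖ ^ 2) (Ici 0) := by
    refine antitoneOn_of_deriv_nonpos (convex_Ici 0)
      (fun s _ ↦ (hder s).continuousAt.continuousWithinAt)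
      (fun s _ ↦ (hder s).differentiableAt.differentiableWithinAt) fun s _ ↦ ?_
    rw [(hder s).deriv]
    nlinarith [sq_nonneg ‖besselEntire (μ + 1) s‖]
  simpa using hanti (mem_Ici.2 le_rfl) (mem_Ici.2 ht) ht

lemma norm_besselEntire_le {μ : ℂ} (hμ : 0 ≤ μ.re) {t : ℝ} (ht : 0 ≤ t) :
    ‖besselEntire μ t‖ ≤ ‖besselEntire μ 0‖ := by
  have := besselEntire_energy_le hμ ht
  refine le_of_sq_le_sq ?_ (norm_nonneg _)
  nlinarith [mul_nonneg ht (sq_nonneg ‖besselEntire (μ + 1) t‖)]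

lemma sqrt_mul_norm_besselEntire_le {μ : ℂ} (hμ : 0 ≤ μ.re) {t : ℝ} (ht : 0 ≤ t) :
    √t * ‖besselEntire (μ + 1) t‖ ≤ ‖besselEntire μ 0‖ := by
  have := besselEntire_energy_le hμ ht
  refine le_of_sq_le_sq ?_ (norm_nonneg _)
  rw [mul_pow, Real.sq_sqrt ht]
  nlinarith [sq_nonneg ‖besselEntire μ t‖]

lemma exists_norm_besselEntire_le_linear {ν : ℂ} (hν : -1 < ν.re) :
    ∃ C : ℝ, 0 ≤ C ∧ ∀ t : ℝ, 0 ≤ t → ‖besselEntire ν t‖ ≤ C * (1 + t) := by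
  have h1 : 0 ≤ (ν + 1).re := by simp; linarith
  have h2 : 0 ≤ (ν + 2).re := by simp; linarith
  refine ⟨‖ν + 1‖ * ‖besselEntire (ν + 1) 0‖ + ‖besselEntire (ν + 2) 0‖, by positivity,
    fun t ht ↦ ?_⟩
  rw [besselEntire_recurrence hν]
  have b1 := norm_besselEntire_le h1 ht
  have b2 := norm_besselEntire_le h2 ht
  calc _ ≤ ‖ν + 1‖ * ‖besselEntire (ν + 1) t‖ + t * ‖besselEntire (ν + 2) t‖ := by
        refine (norm_sub_le _ _).trans (le_of_eq ?_)
        simp [abs_of_nonneg ht]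
    _ ≤ ‖ν + 1‖ * ‖besselEntire (ν + 1) 0‖ + t * ‖besselEntire (ν + 2) 0‖ := by gcongr
    _ ≤ _ := by
        have := mul_nonneg (norm_nonneg (ν + 1)) (norm_nonneg (besselEntire (ν + 1) 0))
        nlinarith [mul_nonneg this ht, norm_nonneg (besselEntire (ν + 2) 0)]

lemma exists_sqrt_pow_mul_norm_besselEntire_le {μ : ℂ} (hμ : 0 ≤ μ.re) (n : ℕ) :
    ∃ C : ℝ, ∀ t : ℝ, 0 ≤ t → √t ^ n * ‖besselEntire (μ + n) t‖ ≤ C := by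
  induction n using Nat.twoStepInduction with
  | zero => exact ⟨_, fun t ht ↦ by simpa using norm_besselEntire_le hμ ht⟩
  | one => exact ⟨_, fun t ht ↦ by simpa using sqrt_mul_norm_besselEntire_le hμ ht⟩
  | more n ih0 ih1 =>
    obtain ⟨C0, h0⟩ := ih0
    obtain ⟨C1, h1⟩ := ih1
    have hn : (0 : ℝ) ≤ n := n.cast_nonneg
    have hre : 0 ≤ (μ + (n + 2 : ℕ)).re := by simp; linarith
    refine ⟨max ‖besselEntire (μ + (n + 2 : ℕ)) 0‖ (‖μ + n + 1‖ * C1 + C0), fun t ht ↦ ?_⟩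
    rcases le_total t 1 with ht1 | ht1
    · refine le_trans ?_ (le_max_left _ _)
      have hs : √t ^ (n + 2) ≤ 1 := pow_le_one₀ (Real.sqrt_nonneg t) (Real.sqrt_le_one.2 ht1)
      calc _ ≤ 1 * ‖besselEntire (μ + (n + 2 : ℕ)) 0‖ := by
            gcongr
            exact norm_besselEntire_le hre ht
        _ = _ := one_mul _
    · refine le_trans ?_ (le_max_right _ _)
      have hrec := besselEntire_recurrence (ν := μ + n) (by simp; linarith) t
      have e1 : μ + n + 1 = μ + (n + 1 : ℕ) := by push_cast; ring
      have e2 : μ + n + 2 = μ + (n + 2 : ℕ) := by push_cast; ring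
      have hmul : t * ‖besselEntire (μ + (n + 2 : ℕ)) t‖ ≤
          ‖μ + n + 1‖ * ‖besselEntire (μ + (n + 1 : ℕ)) t‖ + ‖besselEntire (μ + n) t‖ := by
        have : (t : ℂ) * besselEntire (μ + (n + 2 : ℕ)) t =
            (μ + n + 1) * besselEntire (μ + (n + 1 : ℕ)) t - besselEntire (μ + n) t := by
          rw [← e1, ← e2, hrec]; ring
        have h := congrArg norm this
        rw [norm_mul, Complex.norm_real, Real.norm_of_nonneg ht] at h
        rw [h, ← norm_mul]
        exact norm_sub_le _ _
      have hs1 : 1 ≤ √t := Real.one_le_sqrt.2 ht1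
      calc √t ^ (n + 2) * ‖besselEntire (μ + (n + 2 : ℕ)) t‖
          = √t ^ n * (t * ‖besselEntire (μ + (n + 2 : ℕ)) t‖) := by
            rw [pow_add, Real.sq_sqrt ht]; ring
        _ ≤ √t ^ n * (‖μ + n + 1‖ * ‖besselEntire (μ + (n + 1 : ℕ)) t‖
              + ‖besselEntire (μ + n) t‖) := by gcongr
        _ = ‖μ + n + 1‖ * (√t ^ n * ‖besselEntire (μ + (n + 1 : ℕ)) t‖)
              + √t ^ n * ‖besselEntire (μ + n) t‖ := by ring
        _ ≤ ‖μ + n + 1‖ * (√t ^ (n + 1) * ‖besselEntire (μ + (n + 1 : ℕ)) t‖)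
              + √t ^ n * ‖besselEntire (μ + n) t‖ := by
            gcongr ‖μ + n + 1‖ * (?_ * _) + _
            exact pow_le_pow_right₀ hs1 n.le_succ
        _ ≤ _ := by gcongr; exacts [h1 t ht, h0 t ht]

lemma norm_ofReal_cpow_mul_exp {a p : ℂ} {t : ℝ} (ht : 0 < t) :
    ‖(t : ℂ) ^ a * Complex.exp (-(p * t))‖ = t ^ a.re * Real.exp (-p.re * t) := by
  rw [norm_mul, Complex.norm_cpow_eq_rpow_re_of_pos ht, Complex.norm_exp]
  simp

lemma integrableOn_rpow_mul_exp_neg_mul {s b : ℝ} (hs : -1 < s) (hb : 0 < b) :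
    IntegrableOn (fun t : ℝ ↦ t ^ s * Real.exp (-b * t)) (Ioi 0) := by
  simpa using integrableOn_rpow_mul_exp_neg_mul_rpow hs one_pos hb

lemma integrableOn_cpow_mul_exp {a p : ℂ} (ha : -1 < a.re) (hp : 0 < p.re) :
    IntegrableOn (fun t : ℝ ↦ (t : ℂ) ^ a * Complex.exp (-(p * t))) (Ioi 0) := by
  refine (integrableOn_rpow_mul_exp_neg_mul ha hp).mono'
    (Measurable.aestronglyMeasurable (by fun_prop)) ?_
  filter_upwards [ae_restrict_mem measurableSet_Ioi] with t ht
  exact (norm_ofReal_cpow_mul_exp ht).le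

lemma hasDerivAt_integral_cpow_mul_exp {a p : ℂ} (ha : -1 < a.re) (hp : 0 < p.re) :
    HasDerivAt (fun q : ℂ ↦ ∫ t in Ioi (0 : ℝ), (t : ℂ) ^ a * Complex.exp (-(q * t)))
      (∫ t in Ioi (0 : ℝ), (t : ℂ) ^ a * (Complex.exp (-(p * t)) * -t)) p := by
  have hre : ∀ᶠ q : ℂ in 𝓝 p, p.re / 2 < q.re :=
    Complex.continuous_re.continuousAt.eventually_const_lt (half_lt_self hp)
  refine (hasDerivAt_integral_of_dominated_loc_of_deriv_le
    (F := fun (q : ℂ) (t : ℝ) ↦ (t : ℂ) ^ a * Complex.exp (-(q * t)))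
    (F' := fun q t ↦ (t : ℂ) ^ a * (Complex.exp (-(q * t)) * -t))
    (bound := fun t ↦ t ^ (a.re + 1) * Real.exp (-(p.re / 2) * t)) hre
    (Eventually.of_forall fun q ↦ Measurable.aestronglyMeasurable (by fun_prop))
    (integrableOn_cpow_mul_exp ha hp) (Measurable.aestronglyMeasurable (by fun_prop)) ?_
    (integrableOn_rpow_mul_exp_neg_mul (by linarith) (by linarith)) ?_).2
  · filter_upwards [ae_restrict_mem measurableSet_Ioi] with t ht q hq
    have ht : 0 < t := ht
    rw [← mul_assoc, norm_mul, norm_ofReal_cpow_mul_exp ht, Real.rpow_add_one ht.ne', norm_neg,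
      Complex.norm_real, Real.norm_of_nonneg ht.le, mul_right_comm]
    gcongr
  · filter_upwards with t q _
    have := (((hasDerivAt_id q).mul_const (t : ℂ)).neg.cexp).const_mul ((t : ℂ) ^ a)
    simpa using this

/-- The Laplace transform of a complex power, for a complex parameter in the right half-plane. -/
lemma integral_cpow_mul_exp_neg_mul {a p : ℂ} (ha : 0 < a.re) (hp : 0 < p.re) :
    ∫ t in Ioi (0 : ℝ), (t : ℂ) ^ (a - 1) * Complex.exp (-(p * t)) =
      p ^ (-a) * Complex.Gamma a := by
  have hopen : IsOpen {q : ℂ | 0 < q.re} := isOpen_lt continuous_const Complex.continuous_re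
  have ha' : -1 < (a - 1).re := by simpa using ha
  have hf : AnalyticOnNhd ℂ
      (fun q : ℂ ↦ ∫ t in Ioi (0 : ℝ), (t : ℂ) ^ (a - 1) * Complex.exp (-(q * t)))
      {q : ℂ | 0 < q.re} :=
    DifferentiableOn.analyticOnNhd (fun q hq ↦
      (hasDerivAt_integral_cpow_mul_exp ha' hq).differentiableAt.differentiableWithinAt) hopen
  have hg : AnalyticOnNhd ℂ (fun q : ℂ ↦ q ^ (-a) * Complex.Gamma a) {q : ℂ | 0 < q.re} := by
    refine DifferentiableOn.analyticOnNhd (fun q hq ↦ ?_) hopen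
    exact ((differentiableAt_id.cpow_const (Or.inl hq)).mul_const _).differentiableWithinAt
  refine hf.eqOn_of_preconnected_of_frequently_eq hg
    (convex_halfSpace_re_gt 0).isPreconnected (z₀ := 1) (by simp) ?_ hp
  have hfreq : ∃ᶠ x : ℝ in 𝓝[>] 1,
      ∫ t in Ioi (0 : ℝ), (t : ℂ) ^ (a - 1) * Complex.exp (-((x : ℂ) * t)) =
        (x : ℂ) ^ (-a) * Complex.Gamma a := by
    refine Eventually.frequently ?_
    filter_upwards [self_mem_nhdsWithin] with x hx
    have hx : 0 < x := one_pos.trans hx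
    rw [Complex.integral_cpow_mul_exp_neg_mul_Ioi ha hx, one_div, Complex.inv_cpow,
      Complex.cpow_neg]
    rw [Complex.arg_ofReal_of_nonneg hx.le]
    exact Real.pi_ne_zero.symm
  have htend : Tendsto (fun x : ℝ ↦ (x : ℂ)) (𝓝[>] 1) (𝓝[≠] 1) := by
    refine tendsto_nhdsWithin_iff.2 ⟨?_, ?_⟩
    · have : Tendsto (fun x : ℝ ↦ (x : ℂ)) (𝓝 1) (𝓝 1) := by
        simpa using Complex.continuous_ofReal.tendsto 1
      exact this.mono_left nhdsWithin_le_nhds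
    · filter_upwards [self_mem_nhdsWithin] with x hx
      simpa using (ne_of_gt hx)
  exact htend.frequently hfreq

lemma integral_rpow_mul_exp_neg_mul {s b : ℝ} (hs : -1 < s) (hb : 0 < b) :
    ∫ t in Ioi (0 : ℝ), t ^ s * Real.exp (-b * t) = (1 / b) ^ (s + 1) * Real.Gamma (s + 1) := by
  simpa using Real.integral_rpow_mul_exp_neg_mul_Ioi (a := s + 1) (by linarith) hb

/-- Laplace transform of `y^ν besselEntire ν (x y)`. -/
lemma integral_cpow_mul_exp_mul_besselEntire {ν p : ℂ} (hν : -1 < ν.re) (hp : 0 < p.re) (x : ℝ) :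
    ∫ y in Ioi (0 : ℝ), (y : ℂ) ^ ν * Complex.exp (-(p * y)) * besselEntire ν (x * y) =
      p ^ (-ν - 1) * Complex.exp (-(x / p)) := by
  have hp0 : p ≠ 0 := Complex.ne_zero_of_re_pos hp
  set c : ℕ → ℂ := fun k ↦ (-x : ℂ) ^ k / (k.factorial * Complex.Gamma (k + ν + 1)) with hc
  set F : ℕ → ℝ → ℂ := fun k y ↦ c k * ((y : ℂ) ^ (k + ν) * Complex.exp (-(p * y))) with hF
  have hre : ∀ k : ℕ, -1 < ((k : ℂ) + ν).re := fun k ↦ by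
    have : (0 : ℝ) ≤ k := k.cast_nonneg
    simp
    linarith
  have hFint : ∀ k, IntegrableOn (F k) (Ioi 0) := fun k ↦
    (integrableOn_cpow_mul_exp (hre k) hp).const_mul (c k)
  have hnorm : ∀ k, ∫ y in Ioi (0 : ℝ), ‖F k y‖ =
      ‖c k‖ * ((1 / p.re) ^ (k + ν.re + 1) * Real.Gamma (k + ν.re + 1)) := by
    intro k
    have h1 : ∀ y ∈ Ioi (0 : ℝ), ‖F k y‖ = ‖c k‖ * (y ^ (k + ν.re) * Real.exp (-p.re * y)) := by
      intro y hy
      rw [hF, norm_mul, norm_ofReal_cpow_mul_exp hy]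
      simp
    rw [setIntegral_congr_fun measurableSet_Ioi h1, integral_const_mul,
      integral_rpow_mul_exp_neg_mul (by simpa using hre k) hp]
  have hsum : Summable fun k ↦ ∫ y in Ioi (0 : ℝ), ‖F k y‖ := by
    set K := Real.Gamma (ν.re + 1) / ‖Complex.Gamma (ν + 1)‖
    refine Summable.of_nonneg_of_le (fun k ↦ integral_nonneg fun y ↦ norm_nonneg _) (fun k ↦ ?_)
      ((Real.summable_pow_div_factorial (|x| * (1 / p.re))).mul_left (K * (1 / p.re) ^ (ν.re + 1)))
    rw [hnorm]
    have hck : ‖c k‖ = |x| ^ k / k.factorial / ‖Complex.Gamma (k + ν + 1)‖ := by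
      simp only [hc, norm_div, norm_pow, norm_neg, Complex.norm_natCast,
        Complex.norm_real, Real.norm_eq_abs, div_mul_eq_div_div]
    have hpow : (1 / p.re) ^ (k + ν.re + 1) = (1 / p.re) ^ k * (1 / p.re) ^ (ν.re + 1) := by
      rw [add_assoc, Real.rpow_add (by positivity), Real.rpow_natCast]
    rw [hck, hpow]
    calc _ = (|x| ^ k / k.factorial * (1 / p.re) ^ k * (1 / p.re) ^ (ν.re + 1)) *
          (Real.Gamma (k + ν.re + 1) / ‖Complex.Gamma (k + ν + 1)‖) := by ring
      _ ≤ (|x| ^ k / k.factorial * (1 / p.re) ^ k * (1 / p.re) ^ (ν.re + 1)) * K := by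
          gcongr
          exact Gamma_re_div_norm_Gamma_le hν k
      _ = _ := by rw [mul_pow]; ring
  have hs := hasSum_integral_of_summable_integral_norm hFint hsum
  have hpt : ∀ y ∈ Ioi (0 : ℝ), ∑' k, F k y =
      (y : ℂ) ^ ν * Complex.exp (-(p * y)) * besselEntire ν (x * y) := by
    intro y hy
    have hy0 : (y : ℂ) ≠ 0 := by exact_mod_cast (ne_of_gt hy)
    rw [besselEntire, ← tsum_mul_left]
    refine tsum_congr fun k ↦ ?_
    simp only [hF, hc]
    rw [Complex.cpow_add _ _ hy0, Complex.cpow_natCast, neg_pow, Complex.ofReal_mul, mul_pow]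
    ring
  rw [← setIntegral_congr_fun measurableSet_Ioi hpt]
  refine hs.unique ?_
  have hexp : HasSum (fun k : ℕ ↦ p ^ (-ν - 1) * ((-(x / p)) ^ k / k.factorial))
      (p ^ (-ν - 1) * Complex.exp (-(x / p))) := by
    rw [Complex.exp_eq_exp_ℂ]
    exact (NormedSpace.expSeries_div_hasSum_exp (-(x / p) : ℂ)).mul_left _
  refine hexp.congr_fun fun k ↦ ?_
  simp only [hF]
  rw [integral_const_mul]
  have h := integral_cpow_mul_exp_neg_mul (a := k + ν + 1) (p := p)
    (by have := hre k; simp at this ⊢; linarith) hp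
  rw [add_sub_cancel_right] at h
  have e : -((k : ℂ) + ν + 1) = (-ν - 1) - k := by ring
  have hG := Gamma_natCast_add_ne_zero hν k
  have hf : (k.factorial : ℂ) ≠ 0 := by exact_mod_cast k.factorial_ne_zero
  rw [h, e, Complex.cpow_sub _ _ hp0, Complex.cpow_natCast, neg_pow (x / p : ℂ), div_pow]
  simp only [hc]
  rw [neg_pow (x : ℂ)]
  field_simp

/-- `g` is continuous and decays faster than any power on `[0,∞)`. -/
structure RapidDecay (g : ℝ → ℂ) : Prop where
  continuous : Continuous g
  bound : ∀ m : ℕ, ∃ C : ℝ, ∀ x : ℝ, 0 ≤ x → (1 + x) ^ m * ‖g x‖ ≤ C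

lemma RapidlyDecreasing.rapidDecay_iteratedDeriv {g : ℝ → ℂ} (hg : ContDiff ℝ (⊤ : ℕ∞) g)
    (h : RapidlyDecreasing g) (n : ℕ) : RapidDecay (iteratedDeriv n g) := by
  have hc : Continuous (iteratedDeriv n g) :=
    hg.continuous_iteratedDeriv n (by exact_mod_cast le_top)
  refine ⟨hc, fun m ↦ ?_⟩
  obtain ⟨C, hC⟩ := h m n
  obtain ⟨B, hB⟩ := (isCompact_Icc (a := (0 : ℝ)) (b := 1)).exists_bound_of_continuousOn
    (f := fun x ↦ (1 + x) ^ m * ‖iteratedDeriv n g x‖) (by fun_prop)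
  refine ⟨max B (2 ^ m * C), fun x hx ↦ ?_⟩
  rcases le_total x 1 with hx1 | hx1
  · exact ((le_abs_self _).trans (hB x ⟨hx, hx1⟩)).trans (le_max_left _ _)
  · refine le_trans ?_ (le_max_right _ _)
    calc (1 + x) ^ m * ‖iteratedDeriv n g x‖ ≤ (2 * x) ^ m * ‖iteratedDeriv n g x‖ := by
          gcongr
          linarith
      _ = 2 ^ m * (x ^ m * ‖iteratedDeriv n g x‖) := by rw [mul_pow]; ring
      _ ≤ _ := by gcongr; exact hC x hx1

lemma integrableOn_rpow_mul_inv_one_add_pow {s : ℝ} {N : ℕ} (hs : -1 < s) (hN : s - N < -1) :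
    IntegrableOn (fun x : ℝ ↦ x ^ s * ((1 + x) ^ N)⁻¹) (Ioi 0) := by
  have hm : ∀ S : Set ℝ, AEStronglyMeasurable (fun x : ℝ ↦ x ^ s * ((1 + x) ^ N)⁻¹)
      (volume.restrict S) := fun S ↦ Measurable.aestronglyMeasurable (by fun_prop)
  rw [← Ioc_union_Ioi_eq_Ioi zero_le_one]
  refine IntegrableOn.union ?_ ?_
  · have h := (intervalIntegrable_iff_integrableOn_Ioc_of_le zero_le_one).1
      (intervalIntegral.intervalIntegrable_rpow' (a := 0) (b := 1) hs)
    refine h.mono' (hm _) ?_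
    filter_upwards [ae_restrict_mem measurableSet_Ioc] with x hx
    have hx0 : 0 < x := hx.1
    rw [Real.norm_of_nonneg (by positivity)]
    refine mul_le_of_le_one_right (by positivity) (inv_le_one_of_one_le₀ ?_)
    exact one_le_pow₀ (by linarith)
  · refine (integrableOn_Ioi_rpow_of_lt hN one_pos).mono' (hm _) ?_
    filter_upwards [ae_restrict_mem measurableSet_Ioi] with x hx
    have hx0 : 0 < x := one_pos.trans hx
    rw [Real.norm_of_nonneg (by positivity), Real.rpow_sub hx0, Real.rpow_natCast, div_eq_mul_inv]
    gcongr
    linarith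

lemma integrableOn_rpow_mul_of_bound {s : ℝ} (hs : -1 < s) {φ : ℝ → ℝ}
    (hm : AEStronglyMeasurable φ (volume.restrict (Ioi 0)))
    (hφ : ∀ m : ℕ, ∃ C : ℝ, ∀ x : ℝ, 0 < x → (1 + x) ^ m * ‖φ x‖ ≤ C) :
    IntegrableOn (fun x : ℝ ↦ x ^ s * φ x) (Ioi 0) := by
  obtain ⟨N, hN⟩ := exists_nat_gt (s + 1)
  obtain ⟨C, hC⟩ := hφ N
  refine ((integrableOn_rpow_mul_inv_one_add_pow (N := N) hs (by linarith)).const_mul C).mono'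
    ((Measurable.aestronglyMeasurable (by fun_prop)).mul hm) ?_
  filter_upwards [ae_restrict_mem measurableSet_Ioi] with x hx
  have hx : 0 < x := hx
  rw [norm_mul, Real.norm_of_nonneg (by positivity : 0 ≤ x ^ s)]
  have h : ‖φ x‖ ≤ C * ((1 + x) ^ N)⁻¹ := by
    rw [← div_eq_mul_inv, le_div_iff₀ (by positivity), mul_comm]
    exact hC x hx
  calc _ ≤ x ^ s * (C * ((1 + x) ^ N)⁻¹) := by gcongr
    _ = _ := by ring

lemma RapidDecay.integrableOn {g : ℝ → ℂ} (hg : RapidDecay g) {s : ℝ} (hs : -1 < s) (q : ℕ) :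
    IntegrableOn (fun x : ℝ ↦ x ^ s * ((1 + x) ^ q * ‖g x‖)) (Ioi 0) := by
  have hc := hg.continuous
  refine integrableOn_rpow_mul_of_bound hs (Continuous.aestronglyMeasurable (by fun_prop))
    fun m ↦ ?_
  obtain ⟨C, hC⟩ := hg.bound (m + q)
  refine ⟨C, fun x hx ↦ le_trans (le_of_eq ?_) (hC x hx.le)⟩
  rw [Real.norm_of_nonneg (by positivity), pow_add]
  ring

/-- The integral `∫₀^∞ x^ν g(x) besselEntire ν (x y) dx`, which is the Hankel transform of
`x^{(ν+1)/2} g(x)` up to the factor `y^{(ν+1)/2}`. -/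
noncomputable def besselTransform (ν : ℂ) (g : ℝ → ℂ) (y : ℝ) : ℂ :=
  ∫ x in Ioi (0 : ℝ), (x : ℂ) ^ ν * g x * besselEntire ν (x * y)

lemma RapidDecay.integrableOn_besselEntire {g : ℝ → ℂ} (hg : RapidDecay g) {ν μ : ℂ}
    (hν : -1 < ν.re) (hμ : -1 < μ.re) {y : ℝ} (hy : 0 ≤ y) :
    IntegrableOn (fun x : ℝ ↦ (x : ℂ) ^ ν * g x * besselEntire μ (x * y)) (Ioi 0) := by
  obtain ⟨C, hC, hE⟩ := exists_norm_besselEntire_le_linear hμ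
  have hgm := hg.continuous.measurable
  have hEm := (continuous_besselEntire hμ).measurable
  refine ((hg.integrableOn hν 1).const_mul (C * (1 + y))).mono'
    (Measurable.aestronglyMeasurable (by fun_prop)) ?_
  filter_upwards [ae_restrict_mem measurableSet_Ioi] with x hx
  have hx : 0 < x := hx
  rw [norm_mul, norm_mul, Complex.norm_cpow_eq_rpow_re_of_pos hx]
  calc _ ≤ x ^ ν.re * ‖g x‖ * (C * ((1 + x) * (1 + y))) := by
        gcongr
        refine (hE _ (by positivity)).trans ?_
        gcongr
        nlinarith
    _ = _ := by ring

lemma hasDerivAt_cpow_mul_besselEntire {ν : ℂ} (hν : -1 < ν.re) {x : ℝ} (hx : 0 < x) (y : ℝ) :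
    HasDerivAt (fun x : ℝ ↦ (x : ℂ) ^ (ν + 1) * besselEntire (ν + 1) (x * y))
      ((x : ℂ) ^ ν * besselEntire ν (x * y)) x := by
  have h1 : -1 < (ν + 1).re := by simp; linarith
  have hx0 : (x : ℂ) ≠ 0 := by exact_mod_cast hx.ne'
  have hν0 : ν + 1 ≠ 0 := by simpa using natCast_add_ne_zero hν 0
  have d1 := hasDerivAt_ofReal_cpow_const hx.ne' hν0
  have d2 := (hasDerivAt_besselEntire h1 (x * y)).scomp x ((hasDerivAt_id x).mul_const y)
  refine (d1.mul d2).congr_deriv ?_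
  have e : ν + 1 + 1 = ν + 2 := by ring
  rw [besselEntire_recurrence hν (x * y), e, add_sub_cancel_right, Complex.cpow_add _ _ hx0]
  simp
  ring

lemma besselTransform_eq_neg_deriv {ν : ℂ} (hν : -1 < ν.re) {g g' : ℝ → ℂ}
    (hg : RapidDecay g) (hg' : RapidDecay g') (hder : ∀ x, HasDerivAt g (g' x) x)
    {y : ℝ} (hy : 0 ≤ y) :
    besselTransform ν g y = -besselTransform (ν + 1) g' y := by
  have h1 : -1 < (ν + 1).re := by simp; linarith
  have h1' : 0 < (ν + 1).re := by simp; linarith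
  set v : ℝ → ℂ := fun x ↦ (x : ℂ) ^ (ν + 1) * besselEntire (ν + 1) (x * y) with hv
  set v' : ℝ → ℂ := fun x ↦ (x : ℂ) ^ ν * besselEntire ν (x * y) with hv'
  have hvd : ∀ x ∈ Ioi (0 : ℝ), HasDerivAt v (v' x) x := fun x hx ↦
    hasDerivAt_cpow_mul_besselEntire hν hx y
  have i1 : IntegrableOn (g * v') (Ioi 0) :=
    (hg.integrableOn_besselEntire hν hν hy).congr_fun
      (fun x _ ↦ by simp only [hv', Pi.mul_apply]; ring) measurableSet_Ioi
  have i2 : IntegrableOn (g' * v) (Ioi 0) :=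
    (hg'.integrableOn_besselEntire h1 h1 hy).congr_fun
      (fun x _ ↦ by simp only [hv, Pi.mul_apply]; ring) measurableSet_Ioi
  have i3 : IntegrableOn (g * v) (Ioi 0) :=
    (hg.integrableOn_besselEntire h1 h1 hy).congr_fun
      (fun x _ ↦ by simp only [hv, Pi.mul_apply]; ring) measurableSet_Ioi
  have l0 : Tendsto (g * v) (𝓝[>] 0) (𝓝 0) := by
    have hEc := continuous_besselEntire h1
    have hgc := hg.continuous
    have hpc := Complex.continuous_ofReal_cpow_const h1'
    have hc : Continuous (g * v) := hgc.mul (hpc.mul (by fun_prop))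
    have hz : (g * v) 0 = 0 := by
      have : ν + 1 ≠ 0 := fun h ↦ by simp [h] at h1'
      simp [hv, Complex.zero_cpow this]
    have := hc.tendsto 0
    rw [hz] at this
    exact this.mono_left nhdsWithin_le_nhds
  have lt : Tendsto (g * v) atTop (𝓝 0) :=
    tendsto_zero_of_hasDerivAt_of_integrableOn_Ioi
      (fun x hx ↦ (hder x).mul (hvd x hx)) (i2.add i1) i3
  have key := integral_Ioi_mul_deriv_eq_deriv_mul (fun x _ ↦ hder x) hvd i1 i2 l0 lt
  rw [besselTransform, besselTransform]
  calc _ = ∫ x in Ioi (0 : ℝ), g x * v' x := by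
        congr 1; ext x; simp only [hv']; ring
    _ = -∫ x in Ioi (0 : ℝ), g' x * v x := by rw [key]; ring
    _ = _ := by congr 2; ext x; simp only [hv]; ring

lemma besselTransform_eq_iteratedDeriv {ν : ℂ} (hν : -1 < ν.re) {g : ℝ → ℂ}
    (hg : ContDiff ℝ (⊤ : ℕ∞) g) (hrd : RapidlyDecreasing g) {y : ℝ} (hy : 0 ≤ y) (n : ℕ) :
    besselTransform ν g y = (-1) ^ n * besselTransform (ν + n) (iteratedDeriv n g) y := by
  induction n with
  | zero => simp
  | succ n ih =>
    have hn : (0 : ℝ) ≤ n := n.cast_nonneg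
    have hd : Differentiable ℝ (iteratedDeriv n g) :=
      hg.differentiable_iteratedDeriv n (by exact_mod_cast WithTop.coe_lt_top n)
    have e : ν + n + 1 = ν + (n + 1 : ℕ) := by push_cast; ring
    rw [ih, besselTransform_eq_neg_deriv (g' := iteratedDeriv (n + 1) g) (by simp; linarith)
      (hrd.rapidDecay_iteratedDeriv hg n) (hrd.rapidDecay_iteratedDeriv hg (n + 1))
      (fun x ↦ by rw [iteratedDeriv_succ]; exact (hd x).hasDerivAt) hy, e]
    ring

lemma exists_pow_mul_norm_besselTransform_le {ν : ℂ} (hν : -1 < ν.re) {g : ℝ → ℂ}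
    (hg : ContDiff ℝ (⊤ : ℕ∞) g) (hrd : RapidlyDecreasing g) (k : ℕ) :
    ∃ C : ℝ, ∀ y : ℝ, 0 < y → y ^ k * ‖besselTransform ν g y‖ ≤ C := by
  have hk : (0 : ℝ) ≤ k := k.cast_nonneg
  obtain ⟨C, hC⟩ := exists_sqrt_pow_mul_norm_besselEntire_le (μ := ν + 1)
    (by simp; linarith) (2 * k)
  set G := iteratedDeriv (2 * k + 1) g with hG
  have hGr : RapidDecay G := hrd.rapidDecay_iteratedDeriv hg _
  refine ⟨∫ x in Ioi (0 : ℝ), C * (x ^ (ν.re + 1 + k) * ((1 + x) ^ 0 * ‖G x‖)), fun y hy ↦ ?_⟩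
  have hnorm : y ^ k * ‖besselTransform ν g y‖ =
      ‖∫ x in Ioi (0 : ℝ), (y : ℂ) ^ k * ((x : ℂ) ^ (ν + (2 * k + 1 : ℕ)) * G x *
        besselEntire (ν + (2 * k + 1 : ℕ)) (x * y))‖ := by
    rw [besselTransform_eq_iteratedDeriv hν hg hrd hy.le (2 * k + 1), integral_const_mul, norm_mul,
      norm_mul]
    simp [besselTransform, abs_of_pos hy, hG]
  rw [hnorm]
  refine norm_integral_le_of_norm_le ((hGr.integrableOn (by linarith) 0).const_mul C) ?_
  filter_upwards [ae_restrict_mem measurableSet_Ioi] with x hx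
  have hx : 0 < x := hx
  have hE := hC (x * y) (by positivity)
  have e : ν + 1 + (2 * k : ℕ) = ν + (2 * k + 1 : ℕ) := by push_cast; ring
  rw [pow_mul, Real.sq_sqrt (by positivity), e, mul_pow] at hE
  have hre : (ν + (2 * k + 1 : ℕ)).re = (ν.re + 1 + k) + k := by simp; ring
  rw [norm_mul, norm_mul, norm_mul, Complex.norm_cpow_eq_rpow_re_of_pos hx, hre,
    Real.rpow_add hx, Real.rpow_natCast, norm_pow, Complex.norm_real, Real.norm_of_nonneg hy.le]
  calc _ = (x ^ k * y ^ k * ‖besselEntire (ν + (2 * k + 1 : ℕ)) (x * y)‖) *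
        (x ^ (ν.re + 1 + k) * ‖G x‖) := by ring
    _ ≤ C * (x ^ (ν.re + 1 + k) * ‖G x‖) := by gcongr
    _ = _ := by ring

lemma measurable_besselTransform_integrand {ν : ℂ} (hν : -1 < ν.re) {g : ℝ → ℂ}
    (hg : Continuous g) :
    Measurable fun q : ℝ × ℝ ↦ (q.2 : ℂ) ^ ν * g q.2 * besselEntire ν (q.2 * q.1) := by
  have hgm := hg.measurable
  have hEm := (continuous_besselEntire hν).measurable
  fun_prop

lemma measurable_besselTransform {ν : ℂ} (hν : -1 < ν.re) {g : ℝ → ℂ} (hg : Continuous g) :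
    Measurable (besselTransform ν g) :=
  (StronglyMeasurable.integral_prod_right
    (measurable_besselTransform_integrand hν hg).stronglyMeasurable).measurable

lemma integrableOn_rpow_mul_norm_besselTransform {ν : ℂ} (hν : -1 < ν.re) {g : ℝ → ℂ}
    (hg : ContDiff ℝ (⊤ : ℕ∞) g) (hrd : RapidlyDecreasing g) :
    IntegrableOn (fun y : ℝ ↦ y ^ ν.re * ‖besselTransform ν g y‖) (Ioi 0) := by
  refine integrableOn_rpow_mul_of_bound hν
    (measurable_besselTransform hν hg.continuous).norm.aestronglyMeasurable fun m ↦ ?_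
  obtain ⟨C0, h0⟩ := exists_pow_mul_norm_besselTransform_le hν hg hrd 0
  obtain ⟨C1, h1⟩ := exists_pow_mul_norm_besselTransform_le hν hg hrd m
  refine ⟨2 ^ (m - 1) * (C0 + C1), fun y hy ↦ ?_⟩
  have h0 := h0 y hy
  have h1 := h1 y hy
  rw [norm_norm]
  calc _ ≤ 2 ^ (m - 1) * (1 ^ m + y ^ m) * ‖besselTransform ν g y‖ := by
        gcongr
        exact add_pow_le zero_le_one hy.le m
    _ = 2 ^ (m - 1) * (y ^ 0 * ‖besselTransform ν g y‖ + y ^ m * ‖besselTransform ν g y‖) := by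
        rw [one_pow, pow_zero]; ring
    _ ≤ _ := by gcongr

/-- The Laplace transform of `y^ν besselTransform ν g y`. -/
lemma integral_cpow_mul_exp_mul_besselTransform {ν p : ℂ} (hν : -1 < ν.re) (hp : 0 < p.re)
    {g : ℝ → ℂ} (hg : RapidDecay g) :
    ∫ y in Ioi (0 : ℝ), (y : ℂ) ^ ν * Complex.exp (-(p * y)) * besselTransform ν g y =
      p ^ (-ν - 1) * ∫ x in Ioi (0 : ℝ), (x : ℂ) ^ ν * g x * Complex.exp (-(x / p)) := by
  obtain ⟨C, hC, hE⟩ := exists_norm_besselEntire_le_linear hν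
  have hint : Integrable (Function.uncurry fun y x : ℝ ↦ (y : ℂ) ^ ν * Complex.exp (-(p * y)) *
      ((x : ℂ) ^ ν * g x * besselEntire ν (x * y)))
      ((volume.restrict (Ioi (0 : ℝ))).prod (volume.restrict (Ioi (0 : ℝ)))) := by
    have hy : IntegrableOn (fun y : ℝ ↦ C * (y ^ ν.re * Real.exp (-p.re * y) +
        y ^ (ν.re + 1) * Real.exp (-p.re * y))) (Ioi 0) :=
      ((integrableOn_rpow_mul_exp_neg_mul hν hp).add
        (integrableOn_rpow_mul_exp_neg_mul (by linarith) hp)).const_mul C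
    refine (hy.mul_prod (hg.integrableOn hν 1)).mono' ?_ ?_
    · have := measurable_besselTransform_integrand hν hg.continuous
      refine Measurable.aestronglyMeasurable (Measurable.mul ?_ this)
      fun_prop
    · rw [Measure.prod_restrict]
      filter_upwards [ae_restrict_mem (measurableSet_Ioi.prod measurableSet_Ioi)] with q hq
      obtain ⟨y, x⟩ := q
      have hy : 0 < y := hq.1
      have hx : 0 < x := hq.2
      simp only [Function.uncurry]
      rw [norm_mul, norm_ofReal_cpow_mul_exp hy, norm_mul, norm_mul,
        Complex.norm_cpow_eq_rpow_re_of_pos hx, Real.rpow_add_one hy.ne']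
      calc _ ≤ y ^ ν.re * Real.exp (-p.re * y) *
            (x ^ ν.re * ‖g x‖ * (C * ((1 + x) * (1 + y)))) := by
            gcongr
            refine (hE _ (by positivity)).trans ?_
            gcongr
            nlinarith
        _ = _ := by ring
  have hswap := integral_integral_swap hint
  simp only [integral_const_mul] at hswap
  rw [← integral_const_mul]
  simp only [besselTransform]
  rw [hswap]
  refine integral_congr_ae (Eventually.of_forall fun x ↦ ?_)
  simp only
  calc _ = ∫ y in Ioi (0 : ℝ), (x : ℂ) ^ ν * g x *
        ((y : ℂ) ^ ν * Complex.exp (-(p * y)) * besselEntire ν (x * y)) := by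
        congr 1; ext y; ring
    _ = _ := by
        rw [integral_const_mul, integral_cpow_mul_exp_mul_besselEntire hν hp]
        ring

/-- The identity of `integral_cpow_mul_exp_mul_besselTransform` on the imaginary axis. -/
lemma integral_cpow_mul_exp_mul_besselTransform_of_re_eq_zero {ν p : ℂ} (hν : -1 < ν.re)
    (hp : p.re = 0) (hp0 : p ≠ 0) {g : ℝ → ℂ} (hg : ContDiff ℝ (⊤ : ℕ∞) g)
    (hrd : RapidlyDecreasing g) :
    ∫ y in Ioi (0 : ℝ), (y : ℂ) ^ ν * Complex.exp (-(p * y)) * besselTransform ν g y =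
      p ^ (-ν - 1) * ∫ x in Ioi (0 : ℝ), (x : ℂ) ^ ν * g x * Complex.exp (-(x / p)) := by
  have hslit : p ∈ Complex.slitPlane := Or.inr fun h ↦ hp0 (Complex.ext hp h)
  have hgr : RapidDecay g := by simpa using hrd.rapidDecay_iteratedDeriv hg 0
  have hgm := hg.continuous.measurable
  have hhm := measurable_besselTransform hν hg.continuous
  have hptend : Tendsto (fun ε : ℝ ↦ p + ε) (𝓝[>] 0) (𝓝 p) := by
    have hc : Continuous fun ε : ℝ ↦ p + ε := by fun_prop
    have := hc.tendsto 0
    simp only [Complex.ofReal_zero, add_zero] at this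
    exact this.mono_left nhdsWithin_le_nhds
  have hleft : Tendsto (fun ε : ℝ ↦ ∫ y in Ioi (0 : ℝ),
      (y : ℂ) ^ ν * Complex.exp (-((p + ε) * y)) * besselTransform ν g y) (𝓝[>] 0)
      (𝓝 (∫ y in Ioi (0 : ℝ), (y : ℂ) ^ ν * Complex.exp (-(p * y)) * besselTransform ν g y)) := by
    refine tendsto_integral_filter_of_dominated_convergence
      (fun y ↦ y ^ ν.re * ‖besselTransform ν g y‖)
      (Eventually.of_forall fun ε ↦ Measurable.aestronglyMeasurable (by fun_prop)) ?_
      (integrableOn_rpow_mul_norm_besselTransform hν hg hrd)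
      (Eventually.of_forall fun y ↦ ?_)
    · filter_upwards [self_mem_nhdsWithin] with ε hε
      filter_upwards [ae_restrict_mem measurableSet_Ioi] with y hy
      have hε : 0 < ε := hε
      have hy : 0 < y := hy
      rw [norm_mul, norm_ofReal_cpow_mul_exp hy]
      gcongr
      refine mul_le_of_le_one_right (by positivity) (Real.exp_le_one_iff.2 ?_)
      simp only [Complex.add_re, hp, Complex.ofReal_re, zero_add]
      nlinarith
    · exact (((hptend.mul_const (y : ℂ)).neg.cexp).const_mul ((y : ℂ) ^ ν)).mul_const _
  have hright : Tendsto (fun ε : ℝ ↦ (p + ε) ^ (-ν - 1) * ∫ x in Ioi (0 : ℝ),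
      (x : ℂ) ^ ν * g x * Complex.exp (-(x / (p + ε)))) (𝓝[>] 0)
      (𝓝 (p ^ (-ν - 1) * ∫ x in Ioi (0 : ℝ), (x : ℂ) ^ ν * g x * Complex.exp (-(x / p)))) := by
    refine ((continuousAt_cpow_const hslit).tendsto.comp hptend).mul ?_
    refine tendsto_integral_filter_of_dominated_convergence
      (fun x ↦ x ^ ν.re * ((1 + x) ^ 0 * ‖g x‖))
      (Eventually.of_forall fun ε ↦ Measurable.aestronglyMeasurable (by fun_prop)) ?_
      (hgr.integrableOn hν 0) (Eventually.of_forall fun x ↦ ?_)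
    · filter_upwards [self_mem_nhdsWithin] with ε hε
      filter_upwards [ae_restrict_mem measurableSet_Ioi] with x hx
      have hε : 0 < ε := hε
      have hx : 0 < x := hx
      rw [norm_mul, norm_mul, Complex.norm_cpow_eq_rpow_re_of_pos hx, Complex.norm_exp, pow_zero,
        one_mul]
      refine mul_le_of_le_one_right (by positivity) (Real.exp_le_one_iff.2 ?_)
      have : 0 ≤ ((x : ℂ) / (p + ε)).re := by
        rw [div_eq_mul_inv, Complex.re_ofReal_mul, Complex.inv_re]
        simp only [Complex.add_re, hp, Complex.ofReal_re, zero_add]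
        have := Complex.normSq_nonneg (p + ε)
        positivity
      simpa using this
    · exact ((tendsto_const_nhds.div hptend hp0).neg.cexp).const_mul _
  refine tendsto_nhds_unique hleft (hright.congr' ?_)
  filter_upwards [self_mem_nhdsWithin] with ε hε
  exact (integral_cpow_mul_exp_mul_besselTransform hν (by simpa [hp] using hε) hgr).symm

lemma besselJ_two_mul (ν : ℂ) {s : ℝ} (hs : 0 < s) :
    besselJ ν (2 * s) = (s : ℂ) ^ ν * besselEntire ν (s ^ 2) := by
  have hs0 : (s : ℂ) ≠ 0 := by exact_mod_cast hs.ne'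
  rw [besselJ, besselEntire, ← tsum_mul_left]
  refine tsum_congr fun k ↦ ?_
  have e : (2 : ℂ) * k = ((2 * k : ℕ) : ℂ) := by push_cast; ring
  rw [mul_div_cancel_left₀ s two_ne_zero, Complex.Gamma_nat_eq_factorial, Complex.cpow_add _ _ hs0,
    e, Complex.cpow_natCast, pow_mul]
  push_cast
  ring

lemma sqrt_mul_besselJ (ν : ℂ) {t : ℝ} (ht : 0 < t) :
    (√t : ℂ) * besselJ ν (2 * √t) = (t : ℂ) ^ ((ν + 1) / 2) * besselEntire ν t := by
  have hs : 0 < √t := Real.sqrt_pos.2 ht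
  have hs0 : (√t : ℂ) ≠ 0 := by exact_mod_cast hs.ne'
  have hpow : (t : ℂ) ^ ((ν + 1) / 2) = (√t : ℂ) ^ ν * √t := by
    have e : (ν + 1) / 2 + (ν + 1) / 2 = ν + 1 := by ring
    conv_lhs => rw [← Real.mul_self_sqrt ht.le]
    rw [Complex.ofReal_mul, Complex.mul_cpow_ofReal_nonneg hs.le hs.le,
      ← Complex.cpow_add _ _ hs0, e, Complex.cpow_add _ _ hs0, Complex.cpow_one]
  rw [besselJ_two_mul ν hs, Real.sq_sqrt ht.le, hpow]
  ring

lemma cpow_sub_one_half_mul_cpow_add_one_half (ν : ℂ) {x : ℝ} (hx : 0 < x) :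
    (x : ℂ) ^ ((ν - 1) / 2) * (x : ℂ) ^ ((ν + 1) / 2) = (x : ℂ) ^ ν := by
  rw [← Complex.cpow_add _ _ (by exact_mod_cast hx.ne')]
  ring_nf

lemma hankel_eq_cpow_mul_besselTransform {ν : ℂ} {f g : ℝ → ℂ}
    (hf : ∀ x : ℝ, 0 < x → f x = (x : ℂ) ^ ((ν + 1) / 2) * g x) {y : ℝ} (hy : 0 < y) :
    hankel ν f y = (y : ℂ) ^ ((ν + 1) / 2) * besselTransform ν g y := by
  rw [hankel, besselTransform, ← integral_const_mul]
  refine setIntegral_congr_fun measurableSet_Ioi fun x hx ↦ ?_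
  have hx : 0 < x := hx
  have hx0 : (x : ℂ) ≠ 0 := by exact_mod_cast hx.ne'
  have hpow : (x : ℂ) ^ ((ν + 1) / 2) * (x : ℂ) ^ ((ν + 1) / 2) = (x : ℂ) ^ ν * x := by
    have e : (ν + 1) / 2 + (ν + 1) / 2 = ν + 1 := by ring
    rw [← Complex.cpow_add _ _ hx0, e, Complex.cpow_add _ _ hx0, Complex.cpow_one]
  rw [mul_assoc (f x), sqrt_mul_besselJ ν (mul_pos hx hy), Complex.ofReal_mul,
    Complex.mul_cpow_ofReal_nonneg hx.le hy.le, hf x hx, div_eq_iff hx0]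
  linear_combination (g x * (y : ℂ) ^ ((ν + 1) / 2) * besselEntire ν (x * y)) * hpow

lemma Tnu_eq_integral {ν : ℂ} {f g : ℝ → ℂ}
    (hf : ∀ x : ℝ, 0 < x → f x = (x : ℂ) ^ ((ν + 1) / 2) * g x) (z : ℝ) :
    Tnu ν f z = (((2 * Real.pi) ^ (-(1 : ℝ) / 2) : ℝ) : ℂ) *
      ∫ x in Ioi (0 : ℝ), (x : ℂ) ^ ν * g x * Complex.exp (Complex.I * x * z) := by
  rw [Tnu]
  congr 1
  refine setIntegral_congr_fun measurableSet_Ioi fun x hx ↦ ?_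
  rw [hf x hx, ← mul_assoc, cpow_sub_one_half_mul_cpow_add_one_half ν hx]

lemma neg_I_mul_ofReal_cpow {z : ℝ} (hz : z ≠ 0) (ν : ℂ) :
    (-(Complex.I * z)) ^ (-ν - 1) = ((|z| : ℝ) : ℂ) ^ (-ν - 1) *
      Complex.exp (((Real.sign z * Real.pi : ℝ) : ℂ) * Complex.I * (ν + 1) / 2) := by
  have habs : 0 < |z| := abs_pos.2 hz
  have habs0 : ((|z| : ℝ) : ℂ) ≠ 0 := by exact_mod_cast habs.ne'
  have hp0 : -(Complex.I * z) ≠ 0 := by simp [hz]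
  have hlog : Complex.log (-(Complex.I * z)) =
      Complex.log (|z| : ℝ) - Real.sign z * (Real.pi / 2 * Complex.I) := by
    rw [← Complex.ofReal_log habs.le]
    rcases lt_or_gt_of_ne hz with h | h
    · have e : -(Complex.I * z) = ((|z| : ℝ) : ℂ) * Complex.I := by
        rw [abs_of_neg h]; push_cast; ring
      rw [e, Complex.log_ofReal_mul habs Complex.I_ne_zero, Complex.log_I, Real.sign_of_neg h]
      push_cast
      ring
    · have e : -(Complex.I * z) = ((|z| : ℝ) : ℂ) * -Complex.I := by
        rw [abs_of_pos h]; ring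
      rw [e, Complex.log_ofReal_mul habs (neg_ne_zero.2 Complex.I_ne_zero), Complex.log_neg_I,
        Real.sign_of_pos h]
      push_cast
      ring
  rw [Complex.cpow_def_of_ne_zero hp0, Complex.cpow_def_of_ne_zero habs0, hlog, ← Complex.exp_add]
  congr 1
  push_cast
  ring

/-- `T_ν ∘ H_ν = W_ν ∘ T_ν` on `S_ν([0,∞))` for `Re ν > -1`. -/
theorem Tnu_hankel_eq_Wnu_Tnu (ν : ℂ) (hν : -1 < ν.re) (f : ℝ → ℂ) (hf : MemSnu ν f) :
    ∀ z : ℝ, z ≠ 0 → Tnu ν (hankel ν f) z = Wnu ν (Tnu ν f) z := by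
  obtain ⟨f₁, ⟨g, hg, hfg, hrd⟩, hf₁⟩ := hf
  have hf : ∀ x : ℝ, 0 < x → f x = (x : ℂ) ^ ((ν + 1) / 2) * g x := fun x hx ↦ by
    rw [hf₁ x hx.le, hfg x hx.le]
  intro z hz
  have hz0 : (z : ℂ) ≠ 0 := by exact_mod_cast hz
  have key := integral_cpow_mul_exp_mul_besselTransform_of_re_eq_zero (p := -(Complex.I * z)) hν
    (by simp) (by simp [hz]) hg hrd
  rw [neg_I_mul_ofReal_cpow hz] at key
  rw [Wnu, Tnu_eq_integral (fun y hy ↦ hankel_eq_cpow_mul_besselTransform hf hy),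
    Tnu_eq_integral hf, mul_left_comm]
  congr 1
  convert key using 1
  · congr 1
    ext y
    rw [mul_right_comm]
    ring_nf
  · congr 2
    ext x
    have e : Complex.I * x * ((-1 / z : ℝ) : ℂ) = -(x / -(Complex.I * z)) := by
      push_cast
      field_simp
      simp
    rw [e]
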